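/- Suppose K ⊆ ℝ is a cubic field (a degree-3 extension of ℚ) having exactly one real embedding, and let α, β ∈ K. Then there exists a sequence {ψₙ} of positive integers, tending to infinity, such that lim_{n→∞} ψₙ·‖ψₙ·α‖·‖ψₙ·β‖ = 0. In particular, liminf_{n→∞} n·‖n·α‖·‖n·β‖ = 0, i.e., Littlewood's conjecture holds for the pair (α, β). -/

import Mathlib

open Filter

/-- Distance from a real number to the nearest integer. -/
noncomputable def distNearestInt (x : ℝ) : ℝ := |x - round x|

open NumberField NumberField.ComplexEmbedding

/-- If `u` lies on the unit circle and is not a root of unity, then `c * u ^ n` comes arbitrarily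
close to the imaginary axis along a subsequence. -/
lemma exists_strictMono_tendsto_re_mul_pow (c : ℂ) {u : ℂ} (hu : ‖u‖ = 1)
    (hpow : ∀ m : ℕ, 0 < m → u ^ m ≠ 1) :
    ∃ φ : ℕ → ℕ, StrictMono φ ∧ Tendsto (fun n => (c * u ^ φ n).re) atTop (nhds 0) := by
  have : Fact (0 < 2 * Real.pi) := ⟨Real.two_pi_pos⟩
  set a : AddCircle (2 * Real.pi) := QuotientAddGroup.mk u.arg with ha
  have hexp (n : ℕ) : (AddCircle.homeomorphCircle' (n • a) : ℂ) = u ^ n := by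
    rw [ha, ← AddCircle.coe_nsmul, AddCircle.homeomorphCircle'_apply_mk, Circle.coe_exp]
    conv_rhs => rw [← Complex.norm_mul_exp_arg_mul_I u, hu]
    simp [← Complex.exp_nat_mul, mul_assoc]
  have hord : addOrderOf a = 0 := by
    rw [addOrderOf_eq_zero_iff']
    intro n hn h
    apply hpow n hn
    rw [← hexp, h, ← AddCircle.coe_zero, AddCircle.homeomorphCircle'_apply_mk]
    simp
  have hdense := AddCircle.denseRange_zsmul_iff.mpr hord
  have hcl : MapClusterPt (((Real.pi / 2 - c.arg : ℝ)) : AddCircle (2 * Real.pi)) atTop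
      (fun n : ℕ => n • a) := by
    refine ((mapClusterPt_atTop_nsmul_tfae _ a).out 0 2).mpr ?_
    exact (denseRange_zsmul_iff_nsmul.mp hdense) _
  obtain ⟨φ, hφ, hlim⟩ := hcl.tendsto_subseq
  refine ⟨φ, hφ, ?_⟩
  have hg : Continuous fun x : AddCircle (2 * Real.pi) =>
      (c * (AddCircle.homeomorphCircle' x : ℂ)).re :=
    Complex.continuous_re.comp
      (continuous_const.mul (continuous_subtype_val.comp AddCircle.homeomorphCircle'.continuous))
  have hlim' := (hg.tendsto _).comp hlim
  have hzero : (c * (AddCircle.homeomorphCircle'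
      ((Real.pi / 2 - c.arg : ℝ) : AddCircle (2 * Real.pi)) : ℂ)).re = 0 := by
    rw [AddCircle.homeomorphCircle'_apply_mk, Circle.coe_exp]
    nth_rewrite 1 [← Complex.norm_mul_exp_arg_mul_I c]
    rw [mul_assoc, ← Complex.exp_add]
    have : (c.arg : ℂ) * Complex.I + ((Real.pi / 2 - c.arg : ℝ) : ℂ) * Complex.I
        = Real.pi / 2 * Complex.I := by push_cast; ring
    rw [this, Complex.exp_pi_div_two_mul_I]
    simp
  rw [hzero] at hlim'
  refine hlim'.congr fun n => ?_
  simp only [Function.comp_apply, hexp]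

lemma distNearestInt_nonneg (x : ℝ) : 0 ≤ distNearestInt x := abs_nonneg _

lemma distNearestInt_le (x : ℝ) (p : ℤ) : distNearestInt x ≤ |x - p| := round_le x p

lemma liminf_eq_zero_of_tendsto_comp {f : ℕ → ℝ} (hf : ∀ n, 0 ≤ f n) {ψ : ℕ → ℕ}
    (hψ : Tendsto ψ atTop atTop) (h : Tendsto (fun n => f (ψ n)) atTop (nhds 0)) :
    liminf f atTop = 0 := by
  have hfreq (δ : ℝ) (hδ : 0 < δ) : ∃ᶠ n in atTop, f n ≤ δ :=
    hψ.frequently ((h.eventually (Iic_mem_nhds hδ)).frequently)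
  have hbdd : IsBoundedUnder (· ≥ ·) atTop f := isBoundedUnder_of ⟨0, hf⟩
  refine le_antisymm (le_of_forall_pos_le_add fun δ hδ => ?_) ?_
  · rw [zero_add]
    exact liminf_le_of_frequently_le (hfreq δ hδ) hbdd
  · exact le_liminf_of_le (IsCoboundedUnder.of_frequently_le (hfreq 1 one_pos))
      (Eventually.of_forall hf)

section

variable {K : Type*} [Field K] [NumberField K]

/-- A cubic field with a unique real embedding `ι` has a non-real embedding `σ`, and `ι`, `σ`, `conj σ`
are all its embeddings. -/
lemma exists_complex_embedding_trace_norm (hdeg : Module.finrank ℚ K = 3)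
    (hemb : ∀ f g : K →+* ℝ, f = g) (ι : K →+* ℝ) :
    ∃ σ : K →+* ℂ, ¬ ComplexEmbedding.IsReal σ ∧
      (∀ x, (Algebra.trace ℚ K x : ℝ) = ι x + 2 * (σ x).re) ∧
      ∀ x, (Algebra.norm ℚ x : ℝ) = ι x * ‖σ x‖ ^ 2 := by
  classical
  have hcard : Fintype.card (K →+* ℂ) = 3 := by rw [Embeddings.card, hdeg]
  have : Nontrivial (K →+* ℂ) := Fintype.one_lt_card_iff_nontrivial.mp (by omega)
  set j : K →+* ℂ := Complex.ofRealHom.comp ι with hj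
  obtain ⟨σ, hσ⟩ := exists_ne j
  have hreal : ¬ ComplexEmbedding.IsReal σ := fun h => hσ <| by
    ext x
    rw [← h.coe_embedding_apply, hemb h.embedding ι]
    rfl
  have hconj : conjugate σ ≠ σ := fun h => hreal (isReal_iff.mpr h)
  have hjreal : conjugate j = j := by
    ext x
    simp [hj]
  have hconj' : conjugate σ ≠ j := fun h => hσ <| by
    rw [← hjreal, ← h, involutive_conjugate]
  have huniv : (Finset.univ : Finset (K →+* ℂ)) = {j, σ, conjugate σ} := by
    symm
    rw [← Finset.card_eq_iff_eq_univ, hcard, Finset.card_eq_three]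
    exact ⟨j, σ, conjugate σ, hσ.symm, hconj'.symm, hconj.symm, rfl⟩
  refine ⟨σ, hreal, fun x => ?_, fun x => ?_⟩
  · have h := trace_eq_sum_embeddings (K := ℚ) (L := K) ℂ (x := x)
    rw [← (RingHom.equivRatAlgHom K ℂ).sum_comp, huniv] at h
    rw [Finset.sum_insert (by simp [hσ.symm, hconj'.symm]), Finset.sum_pair hconj.symm] at h
    have hre := congrArg Complex.re h
    simp [hj] at hre
    rw [hre]; ring
  · have h := Algebra.norm_eq_prod_embeddings ℚ ℂ x
    rw [← (RingHom.equivRatAlgHom K ℂ).prod_comp, huniv] at h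
    rw [Finset.prod_insert (by simp [hσ.symm, hconj'.symm]), Finset.prod_pair hconj.symm] at h
    have hre : ((Algebra.norm ℚ x : ℝ) : ℂ) = ((ι x * ‖σ x‖ ^ 2 : ℝ) : ℂ) := by
      simpa [hj, Complex.mul_conj'] using h
    exact_mod_cast hre

/-- A positive power of a unit that is large at the real place and small at the complex one. -/
lemma exists_integral_norm_one (ι : K →+* ℝ) {σ : K →+* ℂ}
    (hσ : ¬ ComplexEmbedding.IsReal σ)
    (hnorm : ∀ x, (Algebra.norm ℚ x : ℝ) = ι x * ‖σ x‖ ^ 2) :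
    ∃ ε : K, IsIntegral ℤ ε ∧ 1 < ι ε ∧ 0 < ‖σ ε‖ ∧ ‖σ ε‖ < 1 ∧ ι ε * ‖σ ε‖ ^ 2 = 1 := by
  set j : K →+* ℂ := Complex.ofRealHom.comp ι with hj
  have hjreal : conjugate j = j := by
    ext x
    simp [hj]
  have hne : InfinitePlace.mk σ ≠ InfinitePlace.mk j := by
    rw [Ne, InfinitePlace.mk_eq_iff]
    rintro (h | h)
    · exact hσ (h ▸ isReal_iff.mpr hjreal)
    · exact hσ (isReal_conjugate_iff.mp (h ▸ isReal_iff.mpr hjreal))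
  obtain ⟨u, hu⟩ := Units.dirichletUnitTheorem.exists_unit K (InfinitePlace.mk j)
  have hlog := hu _ hne
  set x : K := ((u : 𝓞 K) : K) with hx
  have hx0 : x ≠ 0 := Units.coe_ne_zero u
  have hpos : 0 < ‖σ x‖ := norm_pos_iff.mpr ((map_ne_zero σ).mpr hx0)
  have hlt : ‖σ x‖ < 1 := by
    rw [InfinitePlace.apply] at hlog
    exact (Real.log_neg_iff hpos).mp hlog
  have hN : |(Algebra.norm ℚ x : ℝ)| = 1 := by
    exact_mod_cast NumberField.isUnit_iff_norm.mp u.isUnit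
  have hprod : ι (x ^ 2) * ‖σ (x ^ 2)‖ ^ 2 = 1 := by
    rw [map_pow, map_pow, norm_pow]
    rw [hnorm] at hN
    rw [← one_pow 2, ← hN, sq_abs]
    ring
  have hpos2 : 0 < ‖σ (x ^ 2)‖ := by rw [map_pow, norm_pow]; positivity
  have hlt2 : ‖σ (x ^ 2)‖ < 1 := by
    rw [map_pow, norm_pow]; exact pow_lt_one₀ hpos.le hlt two_ne_zero
  refine ⟨x ^ 2, (u : 𝓞 K).isIntegral_coe.pow 2, ?_, hpos2, hlt2, hprod⟩
  by_contra! hle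
  have : ‖σ (x ^ 2)‖ ^ 2 < 1 := pow_lt_one₀ hpos2.le hlt2 two_ne_zero
  nlinarith [sq_nonneg (ι x), map_pow ι x 2, sq_nonneg ‖σ (x ^ 2)‖]

/-- In a field of prime degree, an element with real image under a non-real embedding is rational. -/
lemma apply_eq_of_conj_apply_eq (hdeg : (Module.finrank ℚ K).Prime) (ι : K →+* ℝ)
    {σ : K →+* ℂ} (hσ : ¬ ComplexEmbedding.IsReal σ) {x : K}
    (hx : (starRingEnd ℂ) (σ x) = σ x) : σ x = ι x := by
  have := Subalgebra.isSimpleOrder_of_finrank_prime ℚ K hdeg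
  rcases eq_bot_or_eq_top
    (AlgHom.equalizer (RingHom.equivRatAlgHom K ℂ (conjugate σ)) (RingHom.equivRatAlgHom K ℂ σ))
    with h | h
  · have hmem : x ∈ (⊥ : Subalgebra ℚ K) := h ▸ hx
    obtain ⟨q, rfl⟩ := Algebra.mem_bot.mp hmem
    simp
  · refine absurd (isReal_iff.mpr (RingHom.ext fun y => ?_)) hσ
    have : y ∈ AlgHom.equalizer (RingHom.equivRatAlgHom K ℂ (conjugate σ))
      (RingHom.equivRatAlgHom K ℂ σ) := h ▸ Algebra.mem_top
    exact this

lemma exists_int_trace_eq {x : K} (hx : IsIntegral ℤ x) :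
    ∃ p : ℤ, (Algebra.trace ℚ K x : ℝ) = p := by
  obtain ⟨p, hp⟩ := IsIntegrallyClosed.isIntegral_iff.mp (Algebra.isIntegral_trace (L := ℚ) hx)
  exact ⟨p, by rw [← hp]; simp⟩

lemma trace_mul_sub_trace {ι : K →+* ℝ} {σ : K →+* ℂ}
    (htr : ∀ x, (Algebra.trace ℚ K x : ℝ) = ι x + 2 * (σ x).re) (x a : K) :
    (Algebra.trace ℚ K x : ℝ) * ι a - Algebra.trace ℚ K (x * a)
      = 2 * ((ι a - σ a) * σ x).re := by
  rw [htr, htr]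
  simp
  ring

lemma div_norm_pow_ne_one (hdeg : (Module.finrank ℚ K).Prime) {ι : K →+* ℝ}
    {σ : K →+* ℂ} (hσ : ¬ ComplexEmbedding.IsReal σ) {ε : K} (hι : 1 < ι ε)
    (hpos : 0 < ‖σ ε‖) (hlt : ‖σ ε‖ < 1) {m : ℕ} (hm : 0 < m) :
    (σ ε / ‖σ ε‖) ^ m ≠ 1 := by
  intro h
  rw [div_pow, div_eq_one_iff_eq (by exact_mod_cast (pow_pos hpos m).ne')] at h
  have hreal : σ (ε ^ m) = ι (ε ^ m) :=
    apply_eq_of_conj_apply_eq hdeg ι hσ (by rw [map_pow, h]; simp)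
  rw [map_pow, h, map_pow] at hreal
  have hpowers : ‖σ ε‖ ^ m = ι ε ^ m := by exact_mod_cast hreal
  exact ((pow_lt_one₀ hpos.le hlt hm.ne').trans (one_lt_pow₀ hι hm.ne')).ne hpowers

/-- The sequence is a subsequence of the traces of `y ^ 2 * ε ^ k`, with `ε` a unit of infinite order
and `y` a common denominator of `a` and `b`. -/
theorem exists_tendsto_mul_distNearestInt (hdeg : Module.finrank ℚ K = 3)
    (hemb : ∀ f g : K →+* ℝ, f = g) (ι : K →+* ℝ) (a b : K) :
    ∃ ψ : ℕ → ℕ, (∀ n, 0 < ψ n) ∧ Tendsto ψ atTop atTop ∧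
      Tendsto (fun n => (ψ n : ℝ) * distNearestInt ((ψ n : ℝ) * ι a)
        * distNearestInt ((ψ n : ℝ) * ι b)) atTop (nhds 0) := by
  classical
  obtain ⟨σ, hσ, htr, hnorm⟩ := exists_complex_embedding_trace_norm hdeg hemb ι
  obtain ⟨ε, hεint, hE, hρ0, hρ1, hprod⟩ := exists_integral_norm_one ι hσ hnorm
  obtain ⟨y, hy0, hy⟩ := exists_integral_multiples ℤ ℚ ({a, b} : Finset K)
  set N : ℝ := (y : ℝ) ^ 2
  have hN : 0 < N := by positivity
  set E := ι ε
  set ρ := ‖σ ε‖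
  set u : ℂ := σ ε / ρ with hu
  have hnu : ‖u‖ = 1 := by
    rw [hu, norm_div, Complex.norm_real, norm_norm, div_self hρ0.ne']
  obtain ⟨φ, hφ, hlim⟩ := exists_strictMono_tendsto_re_mul_pow (ι a - σ a) hnu
    fun m hm => div_norm_pow_ne_one (hdeg ▸ Nat.prime_three) hσ hE hρ0 hρ1 hm
  set τ : ℕ → K := fun k => (y : K) ^ 2 * ε ^ k with hτ
  have hτint (k : ℕ) : IsIntegral ℤ (τ k) :=
    ((isIntegral_algebraMap (R := ℤ) (x := y)).pow 2).mul (hεint.pow k)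
  have hτmul (k : ℕ) {x : K} (hx : IsIntegral ℤ (y • x)) : IsIntegral ℤ (τ k * x) := by
    have : τ k * x = y • x * (algebraMap ℤ K y * ε ^ k) := by
      simp only [hτ, zsmul_eq_mul, algebraMap_int_eq, eq_intCast]
      ring
    rw [this]
    exact hx.mul (isIntegral_algebraMap.mul (hεint.pow k))
  have hστ (k : ℕ) : σ (τ k) = ((N * ρ ^ k : ℝ) : ℂ) * u ^ k := by
    have hρ : (ρ : ℂ) ≠ 0 := by exact_mod_cast hρ0.ne'
    have : σ ε = ρ * u := by rw [hu, mul_div_cancel₀ _ hρ]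
    simp only [hτ, N, map_mul, map_pow, map_intCast, this]
    push_cast
    ring
  choose A hA using fun k => exists_int_trace_eq (hτint k)
  have hdist (x : K) (hx : IsIntegral ℤ (y • x)) (k : ℕ) :
      distNearestInt (A k * ι x) ≤ 2 * N * ρ ^ k * |((ι x - σ x) * u ^ k).re| := by
    obtain ⟨p, hp⟩ := exists_int_trace_eq (hτmul k hx)
    refine (distNearestInt_le _ p).trans_eq ?_
    rw [← hA, ← hp, trace_mul_sub_trace htr, hστ, mul_left_comm, Complex.re_ofReal_mul, abs_mul,
      abs_mul, abs_two, abs_of_pos (by positivity)]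
    ring
  have hre (k : ℕ) : |(σ (τ k)).re| ≤ N := by
    refine (Complex.abs_re_le_norm _).trans ?_
    rw [hστ, norm_mul, norm_pow, hnu, one_pow, mul_one, Complex.norm_real,
      Real.norm_of_nonneg (by positivity)]
    exact mul_le_of_le_one_right hN.le (pow_le_one₀ hρ0.le hρ1.le)
  have hAeq (k : ℕ) : (A k : ℝ) = N * E ^ k + 2 * (σ (τ k)).re := by
    rw [← hA, htr]
    simp [hτ, N, E]
  have hAle (k : ℕ) : (A k : ℝ) ≤ 3 * N * E ^ k := by
    have h1 : 1 ≤ E ^ k := one_le_pow₀ hE.le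
    rw [hAeq]
    nlinarith [(abs_le.mp (hre k)).2]
  have hAtop : Tendsto A atTop atTop := by
    rw [← tendsto_intCast_atTop_iff (R := ℝ)]
    refine tendsto_atTop_mono (fun k => ?_) (tendsto_atTop_add_const_right _ (-2 * N)
      ((tendsto_pow_atTop_atTop_of_one_lt hE).const_mul_atTop hN))
    rw [hAeq]
    linarith [(abs_le.mp (hre k)).1]
  obtain ⟨n₀, hn₀⟩ := eventually_atTop.mp (hAtop.eventually_gt_atTop 0)
  set θ : ℕ → ℕ := fun n => φ (n + n₀)
  have hθ : Tendsto θ atTop atTop := hφ.tendsto_atTop.comp (tendsto_add_atTop_nat n₀)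
  have hApos (n : ℕ) : 0 < A (θ n) := hn₀ _ ((Nat.le_add_left n₀ n).trans (hφ.le_apply))
  have hcast (n : ℕ) : (((A (θ n)).toNat : ℕ) : ℝ) = A (θ n) := by
    exact_mod_cast Int.toNat_of_nonneg (hApos n).le
  refine ⟨fun n => (A (θ n)).toNat, fun n => by simpa using hApos n, ?_, ?_⟩
  · rw [← tendsto_natCast_atTop_iff (R := ℤ)]
    refine (hAtop.comp hθ).congr fun n => (Int.toNat_of_nonneg (hApos n).le).symm
  · simp only [hcast]
    have hlim' : Tendsto (fun n => 12 * N ^ 3 * ‖(ι b : ℂ) - σ b‖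
        * |((ι a - σ a) * u ^ θ n).re|) atTop (nhds 0) := by
      simpa using ((hlim.comp (tendsto_add_atTop_nat n₀)).abs).const_mul
        (12 * N ^ 3 * ‖(ι b : ℂ) - σ b‖)
    refine squeeze_zero (fun n => ?_) (fun n => ?_) hlim'
    · have : (0 : ℝ) ≤ A (θ n) := by exact_mod_cast (hApos n).le
      exact mul_nonneg (mul_nonneg this (distNearestInt_nonneg _)) (distNearestInt_nonneg _)
    · have hb : |((ι b - σ b) * u ^ θ n).re| ≤ ‖(ι b : ℂ) - σ b‖ :=
        (Complex.abs_re_le_norm _).trans_eq (by rw [norm_mul, norm_pow, hnu, one_pow, mul_one])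
      have hEpos : 0 < E := one_pos.trans hE
      calc (A (θ n) : ℝ) * distNearestInt (A (θ n) * ι a) * distNearestInt (A (θ n) * ι b)
          ≤ 3 * N * E ^ θ n * (2 * N * ρ ^ θ n * |((ι a - σ a) * u ^ θ n).re|)
            * (2 * N * ρ ^ θ n * ‖(ι b : ℂ) - σ b‖) := by
            gcongr
            · exact distNearestInt_nonneg _
            · exact distNearestInt_nonneg _
            · exact hAle _
            · exact hdist a (hy a (by simp)) _
            · exact (hdist b (hy b (by simp)) _).trans (by gcongr)
        _ = 12 * N ^ 3 * ‖(ι b : ℂ) - σ b‖ * |((ι a - σ a) * u ^ θ n).re|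
            * (E * ρ ^ 2) ^ θ n := by ring
        _ = _ := by rw [hprod, one_pow, mul_one]

end

/-- **Corollary (special case of Littlewood's conjecture).** If `K ⊆ ℝ` is a cubic field with
exactly one real embedding and `α, β ∈ K`, then there is a sequence `ψₙ` of positive integers
tending to infinity with `ψₙ‖ψₙα‖‖ψₙβ‖ → 0`; in particular
`liminf_{n} n‖nα‖‖nβ‖ = 0`. -/
theorem littlewood_for_pair_in_cubic_field
    (K : IntermediateField ℚ ℝ)
    (hdeg : Module.finrank ℚ K = 3)
    (hemb : ∀ f g : K →+* ℝ, f = g)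
    (α β : ℝ) (hα : α ∈ K) (hβ : β ∈ K) :
    (∃ ψ : ℕ → ℕ, (∀ n, 0 < ψ n) ∧ Tendsto ψ atTop atTop ∧
      Tendsto (fun n => (ψ n : ℝ) * distNearestInt ((ψ n : ℝ) * α)
        * distNearestInt ((ψ n : ℝ) * β)) atTop (nhds 0)) ∧
    liminf (fun n : ℕ => (n : ℝ) * distNearestInt ((n : ℝ) * α)
        * distNearestInt ((n : ℝ) * β)) atTop = 0 := by
  have : FiniteDimensional ℚ K := Module.finite_of_finrank_pos (by omega)
  have : NumberField K := ⟨⟩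
  obtain ⟨ψ, hpos, htop, hlim⟩ := exists_tendsto_mul_distNearestInt hdeg hemb
    (algebraMap K ℝ) ⟨α, hα⟩ ⟨β, hβ⟩
  refine ⟨⟨ψ, hpos, htop, hlim⟩, liminf_eq_zero_of_tendsto_comp (fun n => ?_) htop hlim⟩
  exact mul_nonneg (mul_nonneg n.cast_nonneg (distNearestInt_nonneg _)) (distNearestInt_nonneg _)
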